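/- Let A be a standard Borel space and E a countable Borel equivalence relation on A. If a σ-finite Borel measure ν on A is E-invariant (i.e., ν(Dom τ) = ν(Rng τ) for every partial Borel bijection τ whose graph is contained in E), then ν satisfies the mass transport principle: for every Borel function F : E → [0,∞], the integral over A of a ↦ Σ_{a' ∈ E(a)} F(a,a') equals the integral over A of a ↦ Σ_{a' ∈ E(a)} F(a',a). -/

import Mathlib

open MeasureTheory Set
open scoped ENNReal

open Filter Topology ProbabilityTheory

/-- A continuous map on a nonempty compact metrizable set has a Borel section. -/
theorem IsCompact.exists_measurable_section {X A : Type*} [TopologicalSpace X]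
    [TopologicalSpace.MetrizableSpace X] [MeasurableSpace X] [BorelSpace X]
    [TopologicalSpace A] [T2Space A] [MeasurableSpace A] [OpensMeasurableSpace A]
    {K : Set X} (hK : IsCompact K) (hne : K.Nonempty) {f : X → A} (hf : Continuous f) :
    ∃ s : A → X, Measurable s ∧ ∀ a ∈ f '' K, f (s a) = a := by
  let := TopologicalSpace.metrizableSpaceMetric K
  have := isCompact_iff_compactSpace.1 hK
  have := hne.to_subtype
  obtain ⟨q, hq, hqs⟩ := exists_nat_bool_continuous_surjective_of_compact K
  let φ : cantorSet → X := fun x ↦ q (cantorSetHomeomorphNatToBool x)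
  have hφ : Continuous φ :=
    continuous_subtype_val.comp (hq.comp cantorSetHomeomorphNatToBool.continuous)
  let G : cantorSet → A := fun x ↦ f (φ x)
  have hG : Continuous G := hf.comp hφ
  have : CompactSpace cantorSet := isCompact_iff_compactSpace.1 isCompact_cantorSet
  let T : A → Set ℝ := fun a ↦ Subtype.val '' (G ⁻¹' {a})
  let t : A → ℝ := fun a ↦ sInf (T a)
  have hT (a) : IsCompact (T a) :=
    (isClosed_singleton.preimage hG).isCompact.image continuous_subtype_val
  have hTne {a} (ha : a ∈ range G) : (T a).Nonempty := by
    obtain ⟨x, hx⟩ := ha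
    exact ⟨x, x, hx, rfl⟩
  have ht_mem {a} (ha : a ∈ range G) : t a ∈ T a := (hT a).sInf_mem (hTne ha)
  have ht_zero {a} (ha : a ∉ range G) : t a = 0 := by
    have : T a = ∅ := by
      refine eq_empty_of_forall_notMem ?_
      rintro _ ⟨x, hx, rfl⟩
      exact ha ⟨x, hx⟩
    simp [t, this]
  have ht_cantor (a) : t a ∈ cantorSet := by
    by_cases ha : a ∈ range G
    · obtain ⟨x, -, hx⟩ := ht_mem ha
      exact hx ▸ x.2
    · exact ht_zero ha ▸ zero_mem_cantorSet
  have hrange : MeasurableSet (range G) := (isCompact_range hG).measurableSet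
  have ht : Measurable t := by
    refine measurable_of_Iic fun r ↦ ?_
    have : t ⁻¹' Iic r = G '' {x | (x : ℝ) ≤ r} ∪ ((range G)ᶜ ∩ {_a | 0 ≤ r}) := by
      ext a
      by_cases ha : a ∈ range G
      · simp only [mem_preimage, mem_Iic, mem_union, mem_inter_iff, mem_compl_iff, ha,
          not_true_eq_false, false_and, or_false]
        constructor
        · intro h
          obtain ⟨x, hx, hxt⟩ := ht_mem ha
          exact ⟨x, by simpa [hxt] using h, hx⟩
        · rintro ⟨x, hx, hxa⟩
          exact (csInf_le (hT a).bddBelow ⟨x, hxa, rfl⟩).trans hx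
      · have : a ∉ G '' {x | (x : ℝ) ≤ r} := fun h ↦ ha (image_subset_range _ _ h)
        simp [ha, this, ht_zero ha]
    rw [this]
    refine MeasurableSet.union ?_ (hrange.compl.inter (MeasurableSet.const _))
    exact ((isClosed_le continuous_subtype_val continuous_const).isCompact.image hG).measurableSet
  refine ⟨fun a ↦ φ ⟨t a, ht_cantor a⟩, hφ.measurable.comp (ht.subtype_mk), ?_⟩
  rintro _ ⟨x, hx, rfl⟩
  obtain ⟨y, hy⟩ := hqs ⟨x, hx⟩
  have hmem : f x ∈ range G :=
    ⟨cantorSetHomeomorphNatToBool.symm y, by simp [G, φ, hy]⟩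
  obtain ⟨z, hz, hzt⟩ := ht_mem hmem
  have : (⟨t (f x), ht_cantor (f x)⟩ : cantorSet) = z := Subtype.ext hzt.symm
  change f (φ ⟨t (f x), _⟩) = f x
  rw [this]
  exact hz

/-- Continuous images of Baire space are approximated in measure from inside by continuous images
of compact sets. -/
theorem exists_isCompact_le_measure_image {A : Type*} [TopologicalSpace A] [MeasurableSpace A]
    {f : (ℕ → ℕ) → A} (hf : Continuous f) (μ : Measure A) [μ.OuterRegular] {c : ℝ≥0∞}
    (hc : c < μ (range f)) : ∃ K : Set (ℕ → ℕ), IsCompact K ∧ c ≤ μ (f '' K) := by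
  let P : Type := {S : Set (ℕ → ℕ) // c < μ (f '' S)}
  have step (n : ℕ) (S : P) : ∃ m, c < μ (f '' (S.1 ∩ {x | x n ≤ m})) := by
    have hmono : Monotone fun m ↦ f '' (S.1 ∩ {x | x n ≤ m}) := fun m m' h ↦
      image_mono (inter_subset_inter_right _ fun x (hx : x n ≤ m) ↦ hx.trans h)
    have hU : ⋃ m, f '' (S.1 ∩ {x | x n ≤ m}) = f '' S.1 := by
      rw [← image_iUnion, ← inter_iUnion]
      congr 1
      refine inter_eq_left.2 fun x _ ↦ mem_iUnion.2 ⟨x n, le_refl (x n)⟩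
    have := S.2
    rw [← hU, hmono.measure_iUnion, lt_iSup_iff] at this
    exact this
  choose m hm using step
  let S : ℕ → P := fun n ↦ Nat.rec ⟨univ, by simpa using hc⟩ (fun n S ↦ ⟨_, hm n S⟩) n
  let k : ℕ → ℕ := fun n ↦ m n (S n)
  have hS (n) : (S n).1 = {x | ∀ i < n, x i ≤ k i} := by
    induction n with
    | zero => simp [S]
    | succ n ih =>
      have : (S (n + 1)).1 = (S n).1 ∩ {x | x n ≤ k n} := rfl
      rw [this, ih]
      ext x
      exact Nat.forall_lt_succ_right.symm
  let K : Set (ℕ → ℕ) := univ.pi fun i ↦ Iic (k i)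
  have hK : IsCompact K := isCompact_univ_pi fun i ↦ (finite_Iic (k i)).isCompact
  refine ⟨K, hK, ?_⟩
  rw [Set.measure_eq_iInf_isOpen]
  refine le_iInf₂ fun O hO ↦ le_iInf fun hOo ↦ ?_
  suffices ∃ n, (S n).1 ⊆ f ⁻¹' O by
    obtain ⟨n, hn⟩ := this
    exact (S n).2.le.trans (measure_mono (image_subset_iff.2 hn))
  by_contra! h
  simp only [not_subset] at h
  choose x hxS hxO using h
  obtain ⟨y, hyK, ψ, hψ, hy⟩ := hK.tendsto_subseq (x := fun n i ↦ min (x n i) (k i))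
    fun n i _ ↦ min_le_right (x n i) (k i)
  have hx : Tendsto (x ∘ ψ) atTop (𝓝 y) := by
    rw [tendsto_pi_nhds] at hy ⊢
    intro i
    refine (hy i).congr' ?_
    filter_upwards [eventually_gt_atTop i] with n hn
    have := hxS (ψ n)
    rw [hS] at this
    exact min_eq_left (this i (hn.trans_le (hψ.id_le n)))
  have hclosed : IsClosed (f ⁻¹' O)ᶜ := (hOo.preimage hf).isClosed_compl
  exact hclosed.mem_of_tendsto hx (Eventually.of_forall fun n ↦ hxO (ψ n))
    (hO ⟨y, hyK, rfl⟩)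

/-- **Measurable uniformization**: a Borel surjection between standard Borel spaces has a Borel
section almost everywhere. -/
theorem Measurable.exists_ae_section {Z A : Type*} [MeasurableSpace Z] [StandardBorelSpace Z]
    [MeasurableSpace A] [StandardBorelSpace A] {p : Z → A} (hp : Measurable p)
    (hsurj : Function.Surjective p) (ν : Measure A) [SFinite ν] :
    ∃ s : A → Z, Measurable s ∧ ∀ᵐ a ∂ν, p (s a) = a := by
  rcases isEmpty_or_nonempty A with hA | ⟨⟨a₀⟩⟩
  · exact ⟨isEmptyElim, measurable_of_empty _, Eventually.of_forall isEmptyElim⟩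
  obtain ⟨z₀, -⟩ := hsurj a₀
  let := upgradeStandardBorel A
  let tZ := upgradeStandardBorel Z
  obtain ⟨g, hg, hgs, hgc⟩ : ∃ g : (ℕ → ℕ) → Z,
      Continuous g ∧ Function.Surjective g ∧ Continuous (p ∘ g) := by
    obtain ⟨t', ht', hpc, hpol⟩ := hp.exists_continuous
    obtain ⟨g, hg, hgs⟩ := @PolishSpace.exists_nat_nat_continuous_surjective Z t' hpol ⟨z₀⟩
    exact ⟨g, continuous_le_rng ht' hg, hgs, @Continuous.comp _ _ _ _ t' _ _ _ hpc hg⟩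
  have hgm : Measurable g := hg.measurable
  let μ := ν.toFinite
  have hrange : range (p ∘ g) = univ := (hsurj.comp hgs).range_eq
  rcases eq_or_ne (μ univ) 0 with h0 | h0
  · refine ⟨fun _ ↦ z₀, measurable_const, ?_⟩
    have : ν = 0 := by
      rw [← Measure.measure_univ_eq_zero]
      exact absolutelyContinuous_toFinite ν h0
    simp [this]
  obtain ⟨u, -, hu, hulim⟩ := exists_seq_strictMono_tendsto' (pos_iff_ne_zero.2 h0)
  have key (n) : ∃ (B : Set A) (s : A → ℕ → ℕ), MeasurableSet B ∧ u n ≤ μ B ∧ Measurable s ∧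
      ∀ a ∈ B, p (g (s a)) = a := by
    obtain ⟨K, hK, hKu⟩ := exists_isCompact_le_measure_image hgc μ (c := u n)
      (by rw [hrange]; exact (hu n).2)
    have hne : K.Nonempty := by
      rw [nonempty_iff_ne_empty]
      rintro rfl
      simpa using (hu n).1.trans_le hKu
    obtain ⟨s, hs, hsec⟩ := hK.exists_measurable_section hne hgc
    exact ⟨_, s, (hK.image hgc).measurableSet, hKu, hs, hsec⟩
  choose B s hB huB hs hsec using key
  obtain ⟨r, hr, hrs⟩ := exists_measurable_piecewise (disjointed B)
    (fun n ↦ .disjointed hB n) s hs fun i j hij a ha ↦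
      ((disjoint_disjointed B hij).le_bot ha).elim
  refine ⟨g ∘ r, hgm.comp hr, ?_⟩
  have hfull : ∀ᵐ a ∂μ, a ∈ ⋃ n, B n := by
    rw [ae_mem_iff_measure_eq (MeasurableSet.iUnion hB).nullMeasurableSet]
    exact le_antisymm (measure_mono (subset_univ _)) (le_of_tendsto' hulim fun n ↦
      (huB n).trans (measure_mono (subset_iUnion B n)))
  filter_upwards [absolutelyContinuous_toFinite ν |>.ae_le hfull] with a ha
  rw [← iUnion_disjointed] at ha
  obtain ⟨n, hn⟩ := mem_iUnion.1 ha
  simp only [Function.comp_apply, hrs n hn]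
  exact hsec n a (disjointed_subset _ _ hn)

/-- A Borel map which is countable-to-one on `D` is almost everywhere injective on the pieces of a
countable Borel partition of `D`. -/
theorem Measurable.exists_ae_partition_injOn {A B : Type*} [MeasurableSpace A] [StandardBorelSpace A]
    [MeasurableSpace B] [StandardBorelSpace B]
    {D : Set A} (hD : MeasurableSet D) {σ : A → B} (hσ : Measurable σ)
    (hcount : ∀ b, (D ∩ σ ⁻¹' {b}).Countable) (ν : Measure A) [SFinite ν] :
    ∃ C : ℕ → Set A, (∀ n, MeasurableSet (C n)) ∧ Pairwise (Function.onFun Disjoint C) ∧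
      (∀ n, C n ⊆ D) ∧ (∀ n, InjOn σ (C n)) ∧ ∀ᵐ a ∂ν, a ∈ D → a ∈ ⋃ n, C n := by
  rcases isEmpty_or_nonempty A with hA | hA
  · exact ⟨fun _ ↦ ∅, fun _ ↦ .empty, fun _ _ _ ↦ disjoint_bot_left, fun _ ↦ empty_subset _,
      fun _ ↦ injOn_empty _, Eventually.of_forall isEmptyElim⟩
  let := upgradeStandardBorel A
  let μ := ν.toFinite
  let ρ : Measure (B × A) := (μ.restrict D).map fun a ↦ (σ a, a)
  have hpair : Measurable fun a ↦ (σ a, a) := hσ.prodMk measurable_id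
  have hρ : ρ.fst ⊗ₘ ρ.condKernel = ρ := ρ.disintegrate _
  let κ := ρ.condKernel
  -- almost every conditional measure is carried by the fibre
  have hfib : ∀ᵐ b ∂ρ.fst, ∀ᵐ a ∂(κ b), a ∈ D ∩ σ ⁻¹' {b} := by
    have hm : MeasurableSet {q : B × A | q.2 ∈ D ∩ σ ⁻¹' {q.1}} :=
      (measurable_snd hD).inter (measurableSet_eq_fun (hσ.comp measurable_snd) measurable_fst)
    refine Measure.ae_ae_of_ae_compProd (p := fun q : B × A ↦ q.2 ∈ D ∩ σ ⁻¹' {q.1}) ?_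
    rw [hρ, ae_map_iff hpair.aemeasurable hm]
    filter_upwards [ae_restrict_mem hD] with a ha using ⟨ha, rfl⟩
  let w : B → A → ℝ≥0∞ := fun b a ↦ κ b {a}
  have hw : Measurable fun q : B × A ↦ w q.1 q.2 := by
    have := Kernel.measurable_kernel_prodMk_left (κ := κ.comap (Prod.fst : B × A → B) measurable_fst)
      (t := {q : (B × A) × A | q.2 = q.1.2})
      (measurableSet_eq_fun measurable_snd (measurable_snd.comp measurable_fst))
    exact this
  have hpos : ∀ᵐ a ∂(μ.restrict D), w (σ a) a ≠ 0 := by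
    have hm : MeasurableSet {q : B × A | w q.1 q.2 ≠ 0} :=
      hw (measurableSet_singleton 0).compl
    rw [← ae_map_iff (p := fun q : B × A ↦ w q.1 q.2 ≠ 0) hpair.aemeasurable hm]
    change ∀ᵐ q ∂ρ, w q.1 q.2 ≠ 0
    rw [← hρ, Measure.ae_compProd_iff hm]
    filter_upwards [hfib] with b hb
    have : κ b ((D ∩ σ ⁻¹' {b}) ∩ {a | w b a = 0}) = 0 := by
      rw [← biUnion_of_singleton ((D ∩ σ ⁻¹' {b}) ∩ {a | w b a = 0}),
        measure_biUnion_null_iff ((hcount b).mono inter_subset_left)]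
      exact fun a ha ↦ ha.2
    filter_upwards [hb, measure_eq_zero_iff_ae_notMem.1 this] with a ha hna h0
    exact hna ⟨ha, h0⟩
  obtain ⟨𝒰, h𝒰c, -, h𝒰⟩ := TopologicalSpace.exists_countable_basis A
  have hne : 𝒰.Nonempty := by
    by_contra! h
    exact empty_ne_univ (by simpa [h] using h𝒰.sUnion_eq)
  obtain ⟨U, rfl⟩ := h𝒰c.exists_eq_range hne
  have hUo (n) : IsOpen (U n) := h𝒰.isOpen (mem_range_self n)
  let S : ℕ → Set A := fun n ↦ (D ∩ U n) ∩ {a | κ (σ a) (U n) < 2 * w (σ a) a}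
  have hS (n) : MeasurableSet (S n) :=
    (hD.inter (hUo n).measurableSet).inter (measurableSet_lt
      ((κ.measurable_coe (hUo n).measurableSet).comp hσ) ((hw.comp hpair).const_mul 2))
  have hinj (n) : InjOn σ (S n) := by
    rintro a ⟨⟨-, haU⟩, ha⟩ a' ⟨⟨-, haU'⟩, ha'⟩ h
    by_contra hne
    simp only [mem_ofPred_eq] at ha ha'
    rw [← h] at ha'
    have hle : w (σ a) a + w (σ a) a' ≤ κ (σ a) (U n) := by
      rw [← measure_union (by simpa using hne) (measurableSet_singleton _)]
      exact measure_mono (union_subset (by simpa using haU) (by simpa using haU'))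
    refine lt_irrefl (2 * κ (σ a) (U n)) ?_
    calc 2 * κ (σ a) (U n) = κ (σ a) (U n) + κ (σ a) (U n) := two_mul _
      _ < 2 * w (σ a) a + 2 * w (σ a) a' := ENNReal.add_lt_add ha ha'
      _ = 2 * (w (σ a) a + w (σ a) a') := (mul_add _ _ _).symm
      _ ≤ 2 * κ (σ a) (U n) := by gcongr
  refine ⟨disjointed S, fun n ↦ .disjointed hS n, disjoint_disjointed S,
    fun n ↦ (disjointed_subset S n).trans fun a ha ↦ ha.1.1,
    fun n ↦ (hinj n).mono (disjointed_subset S n), ?_⟩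
  rw [iUnion_disjointed]
  refine (absolutelyContinuous_toFinite ν).ae_le ?_
  rw [ae_restrict_iff' hD] at hpos
  filter_upwards [hpos] with a ha haD
  have hlt : κ (σ a) {a} < 2 * w (σ a) a := by
    rw [two_mul]
    exact ENNReal.lt_add_right (measure_ne_top _ _) (ha haD)
  obtain ⟨O, hO, hOo, hOlt⟩ := Set.exists_isOpen_lt_of_lt _ _ hlt
  obtain ⟨_, ⟨n, rfl⟩, han, hnO⟩ := h𝒰.exists_subset_of_mem_open (hO rfl) hOo
  exact mem_iUnion.2 ⟨n, ⟨haD, han⟩, (measure_mono hnO).trans_lt hOlt⟩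

/-- Invariance of a measure under a partial Borel bijection transports integrals. -/
theorem exists_measurable_transport {A : Type*} [MeasurableSpace A] [StandardBorelSpace A]
    {ν : Measure A} {D : Set A} (hD : MeasurableSet D) {τ : A → A} (hτ : Measurable τ)
    (hinj : InjOn τ D) (hν : ∀ S ⊆ D, MeasurableSet S → ν S = ν (τ '' S))
    {G : A → ℝ≥0∞} (hG : Measurable G) :
    ∃ h : A → ℝ≥0∞, Measurable h ∧ (∀ a ∈ D, h (τ a) = G a) ∧ (∀ b ∉ τ '' D, h b = 0) ∧
      ∫⁻ a in D, G a ∂ν = ∫⁻ b, h b ∂ν := by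
  have := hD.standardBorel
  have hemb : MeasurableEmbedding fun a : D ↦ τ a :=
    (hτ.comp measurable_subtype_coe).measurableEmbedding hinj.injective
  have hmap : (ν.restrict D).map τ = ν.restrict (τ '' D) := by
    ext S hS
    rw [Measure.map_apply hτ hS, Measure.restrict_apply (hτ hS), Measure.restrict_apply hS,
      hν _ inter_subset_right ((hτ hS).inter hD), inter_comm, image_inter_preimage, inter_comm]
  let h : A → ℝ≥0∞ := Function.extend (fun a : D ↦ τ a) (fun a ↦ G a) 0
  have hh : Measurable h := hemb.measurable_extend (hG.comp measurable_subtype_coe) measurable_zero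
  have hval (a) (ha : a ∈ D) : h (τ a) = G a :=
    hinj.injective.extend_apply (fun a : D ↦ G a) 0 ⟨a, ha⟩
  have hzero (b) (hb : b ∉ τ '' D) : h b = 0 :=
    Function.extend_apply' _ _ _ fun ⟨a, ha⟩ ↦ hb ⟨a, a.2, ha⟩
  refine ⟨h, hh, hval, hzero, ?_⟩
  calc ∫⁻ a in D, G a ∂ν = ∫⁻ a in D, h (τ a) ∂ν :=
        setLIntegral_congr_fun hD fun a ha ↦ (hval a ha).symm
    _ = ∫⁻ b in τ '' D, h b ∂ν := by rw [← hmap, lintegral_map hh hτ]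
    _ = ∫⁻ b, h b ∂ν := by
        exact setLIntegral_eq_of_support_subset fun b hb ↦ not_not.1 fun hbD ↦ hb (hzero b hbD)

/-- Mass sent along countably many Borel partial injections of `E` with disjoint graphs is bounded
by the total mass received. -/
theorem tsum_setLIntegral_le_lintegral_tsum {A ι : Type*} [MeasurableSpace A]
    [StandardBorelSpace A] [Countable ι] {ν : Measure A} {E : Set (A × A)}
    (hsymm : ∀ a b, (a, b) ∈ E → (b, a) ∈ E)
    {D : ι → Set A} {τ : ι → A → A} (hD : ∀ i, MeasurableSet (D i)) (hτ : ∀ i, Measurable (τ i))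
    (hinj : ∀ i, InjOn (τ i) (D i)) (hE : ∀ i, ∀ a ∈ D i, (a, τ i a) ∈ E)
    (hdisj : ∀ i j a, a ∈ D i → a ∈ D j → τ i a = τ j a → i = j)
    (hν : ∀ i, ∀ S ⊆ D i, MeasurableSet S → ν S = ν (τ i '' S))
    {F : A × A → ℝ≥0∞} (hF : Measurable F) :
    ∑' i, ∫⁻ a in D i, F (a, τ i a) ∂ν ≤ ∫⁻ b, ∑' a : {a // (b, a) ∈ E}, F ((a : A), b) ∂ν := by
  choose h hhm hval hzero hint using fun i ↦ exists_measurable_transport (hD i) (hτ i) (hinj i)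
    (hν i) (hF.comp (measurable_id.prodMk (hτ i)))
  calc ∑' i, ∫⁻ a in D i, F (a, τ i a) ∂ν = ∑' i, ∫⁻ b, h i b ∂ν := tsum_congr hint
    _ = ∫⁻ b, ∑' i, h i b ∂ν := (lintegral_tsum fun i ↦ (hhm i).aemeasurable).symm
    _ ≤ _ := lintegral_mono fun b ↦ ?_
  let J : Set ι := {i | b ∈ τ i '' D i}
  have hJ : Function.support (fun i ↦ h i b) ⊆ J :=
    fun i hi ↦ not_not.1 fun hb ↦ hi (hzero i b hb)
  rw [← tsum_subtype_eq_of_support_subset hJ]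
  choose r hrD hrb using fun i : J ↦ i.2
  let e : J → {a // (b, a) ∈ E} := fun i ↦ ⟨r i, hsymm _ _ (by simpa [hrb i] using hE i _ (hrD i))⟩
  have he : Function.Injective e := by
    intro i j hij
    have hr : r i = r j := congrArg Subtype.val hij
    exact Subtype.ext (hdisj i j (r i) (hrD i) (hr ▸ hrD j) (by rw [hrb i, hr, hrb j]))
  calc ∑' i : J, h i b = ∑' i : J, F ((e i : A), b) := by
        refine tsum_congr fun i ↦ ?_
        conv_lhs => rw [← hrb i, hval i _ (hrD i)]
        simp [e, hrb i]
    _ ≤ _ := ENNReal.tsum_comp_le_tsum_of_injective he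
      fun a : {a // (b, a) ∈ E} ↦ F ((a : A), b)

/-- A number strictly below an infinite sum is at most the sum over finitely many distinct terms,
listed by a sequence. -/
theorem ENNReal.exists_seq_of_lt_tsum_subtype {A : Type*} [Nonempty A] {P : Set A}
    {f : A → ℝ≥0∞} {c : ℝ≥0∞} (hc : c < ∑' b : P, f b) :
    ∃ (n : ℕ) (x : ℕ → A), (∀ i < n, x i ∈ P) ∧ (∀ i < n, ∀ j < n, x i = x j → i = j) ∧
      c ≤ ∑ i ∈ Finset.range n, f (x i) := by
  rw [ENNReal.tsum_eq_iSup_sum, lt_iSup_iff] at hc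
  obtain ⟨t, ht⟩ := hc
  let e := t.equivFin
  let x : ℕ → A := fun i ↦ if h : i < t.card then (e.symm ⟨i, h⟩ : P) else Classical.arbitrary A
  have hx (i) (h : i < t.card) : x i = (e.symm ⟨i, h⟩ : P) := by simp [x, h]
  refine ⟨t.card, x, fun i hi ↦ ?_, fun i hi j hj hij ↦ ?_, ht.le.trans_eq ?_⟩
  · rw [hx i hi]
    exact (e.symm ⟨i, hi⟩ : P).2
  · rw [hx i hi, hx j hj] at hij
    simpa using e.symm.injective (Subtype.ext (Subtype.ext hij))
  · rw [← Fin.sum_univ_eq_sum_range (fun i ↦ f (x i)), ← t.sum_coe_sort, ← e.symm.sum_comp]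
    exact Finset.sum_congr rfl fun i _ ↦ by rw [hx i i.2]

/-- One inequality of the mass transport principle: the mass sent out is at most the mass
received. -/
theorem lintegral_tsum_le_lintegral_tsum_swap
    {A : Type*} [MeasurableSpace A] [StandardBorelSpace A]
    (E : Set (A × A)) (hE : MeasurableSet E)
    (hsymm : ∀ a b, (a, b) ∈ E → (b, a) ∈ E)
    (hcount : ∀ a, {b | (a, b) ∈ E}.Countable)
    (ν : Measure A) [SigmaFinite ν]
    (hinv : ∀ (D : Set A) (τ : A → A), MeasurableSet D → Measurable τ →
      Set.InjOn τ D → (∀ a ∈ D, (a, τ a) ∈ E) → MeasurableSet (τ '' D) →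
      ν D = ν (τ '' D))
    (F : A × A → ℝ≥0∞) (hF : Measurable F) :
    ∫⁻ a, (∑' b : {b // (a, b) ∈ E}, F (a, (b : A))) ∂ν
      ≤ ∫⁻ a, (∑' b : {b // (a, b) ∈ E}, F ((b : A), a)) ∂ν := by
  rcases isEmpty_or_nonempty A with hA | hA
  · simp [Measure.eq_zero_of_isEmpty ν]
  rw [lintegral_eq_nnreal]
  refine iSup₂_le fun φ hφ ↦ ?_
  rw [← SimpleFunc.lintegral_eq_lintegral]
  refine ENNReal.le_of_forall_lt_one_mul_le fun r hr ↦ ?_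
  rw [← lintegral_const_mul _ (SimpleFunc.measurable _)]
  let g : A → ℝ≥0∞ := fun a ↦ r * φ a
  have hg : Measurable g := (φ.measurable.coe_nnreal_ennreal).const_mul _
  change ∫⁻ a, g a ∂ν ≤ _
  -- finite families of distinct points of the class of `a` carrying mass at least `g a`
  let W : Set (A × (ℕ → A) × ℕ) := {z | (∀ i < z.2.2, (z.1, z.2.1 i) ∈ E) ∧
    (∀ i < z.2.2, ∀ j < z.2.2, z.2.1 i = z.2.1 j → i = j) ∧
    g z.1 ≤ ∑ i ∈ Finset.range z.2.2, F (z.1, z.2.1 i)}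
  have hW : MeasurableSet W := by
    have hcoord (i : ℕ) : Measurable fun z : A × (ℕ → A) × ℕ ↦ z.2.1 i := by fun_prop
    have hmass (n : ℕ) : Measurable fun z : A × (ℕ → A) × ℕ ↦
        ∑ i ∈ Finset.range n, F (z.1, z.2.1 i) :=
      Finset.measurable_fun_sum _ fun i _ ↦ hF.comp (measurable_fst.prodMk (hcoord i))
    have hlevel (n : ℕ) : MeasurableSet {z : A × (ℕ → A) × ℕ | z.2.2 = n} :=
      measurable_snd.snd (measurableSet_singleton n)
    have : W = ⋃ n, {z | z.2.2 = n} ∩ ((⋂ i < n, {z | (z.1, z.2.1 i) ∈ E}) ∩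
        ((⋂ i < n, ⋂ j < n, {z | z.2.1 i = z.2.1 j → i = j}) ∩
          {z | g z.1 ≤ ∑ i ∈ Finset.range n, F (z.1, z.2.1 i)})) := by
      ext z
      simp [W]
    rw [this]
    refine .iUnion fun n ↦ (hlevel n).inter (.inter ?_ (.inter ?_ ?_))
    · exact .iInter fun i ↦ .iInter fun _ ↦ (measurable_fst.prodMk (hcoord i)) hE
    · exact .iInter fun i ↦ .iInter fun _ ↦ .iInter fun j ↦ .iInter fun _ ↦
        (measurableSet_eq_fun (hcoord i) (hcoord j)).imp (.const _)
    · exact measurableSet_le (hg.comp measurable_fst) (hmass n)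
  have := hW.standardBorel
  have hsurj : Function.Surjective fun z : W ↦ z.1.1 := by
    intro a
    rcases eq_or_ne (g a) 0 with h0 | h0
    · exact ⟨⟨(a, fun _ ↦ a, 0), by simp [W, h0]⟩, rfl⟩
    · have hlt : g a < ∑' b : {b | (a, b) ∈ E}, F (a, (b : A)) := by
        refine lt_of_lt_of_le ?_ (hφ a)
        have hφ0 : (φ a : ℝ≥0∞) ≠ 0 := fun h ↦ h0 (by simp [g, h])
        simpa [g] using ENNReal.mul_lt_mul_left hφ0 ENNReal.coe_ne_top hr
      obtain ⟨n, x, h1, h2, h3⟩ :=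
        ENNReal.exists_seq_of_lt_tsum_subtype (f := fun b ↦ F (a, b)) hlt
      exact ⟨⟨(a, x, n), h1, h2, h3⟩, rfl⟩
  obtain ⟨s, hs, hsec⟩ :=
    (measurable_fst.comp measurable_subtype_coe).exists_ae_section hsurj ν
  let σ : ℕ → A → A := fun i a ↦ (s a).1.2.1 i
  let N : A → ℕ := fun a ↦ (s a).1.2.2
  have hσ (i) : Measurable (σ i) := by fun_prop
  have hN : Measurable N := by fun_prop
  let B : Set A := {a | (s a).1.1 = a}
  have hB : MeasurableSet B := measurableSet_eq_fun (by fun_prop) measurable_id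
  let D : ℕ → Set A := fun i ↦ B ∩ {a | i < N a}
  have hD (i) : MeasurableSet (D i) := hB.inter (measurableSet_lt measurable_const hN)
  have hDE (i a) (ha : a ∈ D i) : (a, σ i a) ∈ E := by
    have := (s a).2.1 i ha.2
    rwa [ha.1] at this
  have hDinj (i j a) (hi : a ∈ D i) (hj : a ∈ D j) (h : σ i a = σ j a) : i = j :=
    (s a).2.2.1 i hi.2 j hj.2 h
  choose C hC hCd hCD hCinj hCae using fun i ↦ (hσ i).exists_ae_partition_injOn (hD i)
    (fun b ↦ (hcount b).mono fun a ha ↦ hsymm _ _ (by simpa [ha.2.symm] using hDE i a ha.1)) ν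
  calc ∫⁻ a, g a ∂ν ≤ ∫⁻ a, ∑' i, (D i).indicator (fun a ↦ F (a, σ i a)) a ∂ν := by
        refine lintegral_mono_ae ?_
        filter_upwards [hsec] with a ha
        have h3 := (s a).2.2.2
        change (s a).1.1 = a at ha
        rw [ha] at h3
        refine h3.trans ((Finset.sum_le_sum fun i hi ↦ ?_).trans (ENNReal.sum_le_tsum _))
        rw [indicator_of_mem (show a ∈ D i from ⟨ha, Finset.mem_range.1 hi⟩)]
    _ = ∑' i, ∫⁻ a in D i, F (a, σ i a) ∂ν := by
        rw [lintegral_tsum fun i ↦ Measurable.aemeasurable ?_]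
        · exact tsum_congr fun i ↦ lintegral_indicator (hD i) _
        · exact Measurable.indicator (hF.comp (measurable_id.prodMk (hσ i))) (hD i)
    _ = ∑' i, ∑' n, ∫⁻ a in C i n, F (a, σ i a) ∂ν := by
        refine tsum_congr fun i ↦ ?_
        rw [← lintegral_iUnion (hC i) (hCd i)]
        refine setLIntegral_congr ?_
        filter_upwards [hCae i] with a ha
        exact propext ⟨ha, fun h ↦ iUnion_subset (hCD i) h⟩
    _ = ∑' q : ℕ × ℕ, ∫⁻ a in C q.1 q.2, F (a, σ q.1 a) ∂ν :=
        (ENNReal.tsum_prod (f := fun i n ↦ ∫⁻ a in C i n, F (a, σ i a) ∂ν)).symm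
    _ ≤ _ := by
        refine tsum_setLIntegral_le_lintegral_tsum (D := fun q : ℕ × ℕ ↦ C q.1 q.2)
          (τ := fun q ↦ σ q.1) hsymm (fun q ↦ hC _ _) (fun q ↦ hσ _) (fun q ↦ hCinj _ _)
          (fun q a ha ↦ hDE _ a (hCD _ _ ha)) ?_ ?_ hF
        · rintro ⟨i, n⟩ ⟨j, m⟩ a hi hj h
          obtain rfl : i = j := hDinj i j a (hCD _ _ hi) (hCD _ _ hj) h
          by_contra hne
          exact (hCd i (show n ≠ m by rintro rfl; exact hne rfl)).le_bot ⟨hi, hj⟩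
        · intro q S hS hSm
          have hinj := (hCinj q.1 q.2).mono hS
          exact hinv S (σ q.1) hSm (hσ _) hinj (fun a ha ↦ hDE _ a (hCD _ _ (hS ha)))
            (hSm.image_of_measurable_injOn (hσ _) hinj)

/-- **Mass transport principle for invariant measures on countable Borel
equivalence relations.** If a σ-finite Borel measure `ν` on a standard Borel
space `A` is invariant under every partial Borel bijection whose graph is
contained in a countable Borel equivalence relation `E`, then for every Borel
function `F : E → [0,∞]` the integrals of the forward and backward
periodizations agree. -/
theorem mass_transport_principle
    {A : Type*} [MeasurableSpace A] [StandardBorelSpace A]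
    (E : Set (A × A)) (hE : MeasurableSet E)
    (hrefl : ∀ a, (a, a) ∈ E)
    (hsymm : ∀ a b, (a, b) ∈ E → (b, a) ∈ E)
    (htrans : ∀ a b c, (a, b) ∈ E → (b, c) ∈ E → (a, c) ∈ E)
    (hcount : ∀ a, {b | (a, b) ∈ E}.Countable)
    (ν : Measure A) [SigmaFinite ν]
    (hinv : ∀ (D : Set A) (τ : A → A), MeasurableSet D → Measurable τ →
      Set.InjOn τ D → (∀ a ∈ D, (a, τ a) ∈ E) → MeasurableSet (τ '' D) →
      ν D = ν (τ '' D))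
    (F : A × A → ℝ≥0∞) (hF : Measurable F) :
    ∫⁻ a, (∑' b : {b // (a, b) ∈ E}, F (a, (b : A))) ∂ν
      = ∫⁻ a, (∑' b : {b // (a, b) ∈ E}, F ((b : A), a)) ∂ν := by
  exact le_antisymm (lintegral_tsum_le_lintegral_tsum_swap E hE hsymm hcount ν hinv F hF)
    (lintegral_tsum_le_lintegral_tsum_swap E hE hsymm hcount ν hinv (fun q ↦ F q.swap)
      (hF.comp measurable_swap))
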